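/- arXiv:math/0303098 — 2 statements merged into one kernel-verified Lean document; each statement's English description precedes it below -/
import Mathlib

section
/- Let B be a basis of V such that Gr(B) is connected. Then every nonzero x∈V can be written as x = x₁+⋯+x_s with all x_i∈Δ and Ω(x_i,x_j)=0 for all i,j (so that d(x) is well defined), and two vectors x,y ∈ V∖V₀ lie in the same Γ_B-orbit if and only if d(x)=d(y). -/
open scoped BigOperators

/-- A `ZMod 2`-valued bilinear form on `V`. -/
abbrev BForm (V : Type*) [AddCommGroup V] [Module (ZMod 2) V] :=
  V →ₗ[ZMod 2] V →ₗ[ZMod 2] ZMod 2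

variable {V : Type*} [AddCommGroup V] [Module (ZMod 2) V]

/-- `g` is the transvection `τ_b : x ↦ x + Ω(x,b)·b` for some `b ∈ B`. -/
def IsTransvection (Ω : BForm V) (B : Set V) (g : V ≃ₗ[ZMod 2] V) : Prop :=
  ∃ b ∈ B, ∀ x : V, g x = x + Ω x b • b

/-- The group `Γ_B` generated by the transvections `τ_b`, `b ∈ B`. -/
def Gamma (Ω : BForm V) (B : Set V) : Subgroup (V ≃ₗ[ZMod 2] V) :=
  Subgroup.closure {g | IsTransvection Ω B g}

/-- `x` and `y` lie in the same `Γ_B`-orbit. -/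
def SameOrbit (Ω : BForm V) (B : Set V) (x y : V) : Prop :=
  ∃ g ∈ Gamma Ω B, g x = y

/-- The graph `Gr(X)` on vertex set `X`, with `b, b'` adjacent iff `Ω(b,b') = 1` or `Ω(b',b) = 1`. -/
def Gr (Ω : BForm V) (X : Set V) : SimpleGraph X :=
  SimpleGraph.fromRel fun a b => Ω a.1 b.1 = 1

/-- One basic move: `B' = φ_{c,a}(B)`, replacing `c` by `c + a`. -/
def MoveRel (Ω : BForm V) (B B' : Set V) : Prop :=
  ∃ a c, a ∈ B ∧ c ∈ B ∧ a ≠ c ∧ Ω a c = 1 ∧ B' = insert (c + a) (B \ {c})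

/-- `B` and `B'` are equivalent: related by a finite sequence of basic moves. -/
def EquivSets (Ω : BForm V) : Set V → Set V → Prop :=
  Relation.ReflTransGen (MoveRel Ω)

/-- The kernel `V₀` of the form `Ω`. -/
def V0set (Ω : BForm V) : Set V := {x | ∀ v : V, Ω x v = 0}

/-- `Δ`, the `Γ_B`-orbit containing `B` (when `Gr(B)` is connected). -/
def Delta (Ω : BForm V) (B : Set V) : Set V :=
  {x | ∃ b ∈ B, SameOrbit Ω B b x}

/-- `V₀₀₀`: vectors of `V₀` of the form `x₁ + x₂` with `x₁, x₂ ∈ Δ`. -/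
def V000set (Ω : BForm V) (B : Set V) : Set V :=
  {y | y ∈ V0set Ω ∧ ∃ x₁ ∈ Delta Ω B, ∃ x₂ ∈ Delta Ω B, y = x₁ + x₂}

/-- `U₀₀₀` for `U = span(B)`: vectors of `U₀` of the form `x₁ + x₂` with `x₁, x₂ ∈ Δ`. -/
def U000set (Ω : BForm V) (B : Set V) : Set V :=
  {y | y ∈ Submodule.span (ZMod 2) B ∧ (∀ u ∈ Submodule.span (ZMod 2) B, Ω y u = 0) ∧
    ∃ x₁ ∈ Delta Ω B, ∃ x₂ ∈ Delta Ω B, y = x₁ + x₂}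

/-- `x = x₁ + ⋯ + x_s` with all `x_i ∈ Δ` and `Ω(x_i, x_j) = 0`: a `Δ`-decomposition. -/
def HasDeltaDecomp (Ω : BForm V) (B : Set V) (x : V) (s : ℕ) : Prop :=
  1 ≤ s ∧ ∃ f : Fin s → V, (∀ i, f i ∈ Delta Ω B) ∧
    (∀ i j, i ≠ j → Ω (f i) (f j) = 0) ∧ x = ∑ i, f i

/-- `d(x)`: minimal length of a `Δ`-decomposition of `x`. -/
noncomputable def dval (Ω : BForm V) (B : Set V) (x : V) : ℕ :=
  sInf {s | HasDeltaDecomp Ω B x s}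

/-- `Q` is the quadratic form associated with `Ω` and `S` (`Q(b)=1` on `S`, polarization `Ω`). -/
def IsQuadForm (Ω : BForm V) (S : Set V) (Q : V → ZMod 2) : Prop :=
  (∀ b ∈ S, Q b = 1) ∧ ∀ u v : V, Q (u + v) = Q u + Q v + Ω u v

/-- The tree of type `D_{m,k}`: path `a₁ — ⋯ — a_m` with leaves `c₁, …, c_k` attached to `a_m`. -/
def DmkGraph (m k : ℕ) : SimpleGraph (Fin m ⊕ Fin k) :=
  SimpleGraph.fromRel fun x y =>
    match x, y with
    | Sum.inl i, Sum.inl j => i.val + 1 = j.val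
    | Sum.inl i, Sum.inr _ => i.val + 1 = m
    | _, _ => False

/-- The Dynkin tree `E₆`. -/
def E6Graph : SimpleGraph (Fin 6) :=
  SimpleGraph.fromRel fun i j => (i.val, j.val) ∈ [(0,1),(1,2),(2,3),(3,4),(2,5)]

/-- Two triangles sharing a common edge: four vertices, five edges. -/
def TwoTrianglesGraph : SimpleGraph (Fin 4) :=
  SimpleGraph.fromRel fun i j => (i.val, j.val) ∈ [(0,1),(0,2),(0,3),(1,2),(1,3)]

/-- The cycle of length `n`. -/
def CycleGraph (n : ℕ) : SimpleGraph (Fin n) :=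
  SimpleGraph.fromRel fun i j => j.val = (i.val + 1) % n

/-- Membership in the family `F`: type `D_{2,2}`, two triangles sharing an edge,
or a cycle of length at least `4`. -/
def InF {α : Type*} (G : SimpleGraph α) : Prop :=
  Nonempty (G ≃g DmkGraph 2 2) ∨ Nonempty (G ≃g TwoTrianglesGraph) ∨
    ∃ n, 4 ≤ n ∧ Nonempty (G ≃g CycleGraph n)

/-- `B` is equivalent to a set whose graph is a tree of type `D_{m,k}`. -/
def EquivToDmkTree (Ω : BForm V) (B : Set V) (m k : ℕ) : Prop :=
  ∃ B' : Set V, EquivSets Ω B B' ∧ Nonempty (Gr Ω B' ≃g DmkGraph m k)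

/-- `X` is equivalent to a set whose graph is `E₆`. -/
def EquivToE6 (Ω : BForm V) (X : Set V) : Prop :=
  ∃ X' : Set V, EquivSets Ω X X' ∧ Nonempty (Gr Ω X' ≃g E6Graph)

/-- Some subset of `B` is equivalent to a set whose graph is `E₆`. -/
def HasE6Subgraph (Ω : BForm V) (B : Set V) : Prop :=
  ∃ X ⊆ B, EquivToE6 Ω X

/-- `B` is a basis of `V` (as a set). -/
def IsBasisSet (B : Set V) : Prop :=
  LinearIndependent (ZMod 2) (Subtype.val : B → V) ∧ Submodule.span (ZMod 2) B = ⊤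

/-- `B` is equivalent to a set whose graph is a tree containing `E₆` as an induced subgraph. -/
def EquivToE6Tree (Ω : BForm V) (B : Set V) : Prop :=
  ∃ B' : Set V, EquivSets Ω B B' ∧ (Gr Ω B').IsTree ∧
    ∃ X ⊆ B', Nonempty (Gr Ω X ≃g E6Graph)

/-- `A` is a maximal complete subgraph (maximal clique) of `G`. -/
def IsMaxClique {α : Type*} (G : SimpleGraph α) (A : Set α) : Prop :=
  G.IsClique A ∧ ∀ A', G.IsClique A' → A ⊆ A' → A' = A

/-- An alternating form over `𝔽₂` is symmetric. -/
lemma alternating_symm (Ω : BForm V) (hΩ : ∀ x, Ω x x = 0) (u v : V) : Ω u v = Ω v u := by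
  have h := hΩ (u + v)
  simp only [map_add, LinearMap.add_apply, hΩ, zero_add, add_zero] at h
  generalize Ω u v = s at *
  generalize Ω v u = t at *
  revert s t
  decide

lemma zmod_two_cases (t : ZMod 2) : t = 0 ∨ t = 1 := by
  revert t
  decide

lemma add_self_zmod_two (u : V) : u + u = 0 := by
  rw [← two_smul (ZMod 2) u, show (2 : ZMod 2) = 0 from rfl, zero_smul]

/-- `D` is closed under its own transvections, and the graph on `D` defined by `Ω` is
connected. -/
structure IsVanishing (Ω : BForm V) (D : Set V) : Prop where
  add_mem : ∀ a ∈ D, ∀ b ∈ D, Ω a b = 1 → a + b ∈ D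
  conn : ∀ a ∈ D, ∀ b ∈ D, Relation.ReflTransGen (fun u v => v ∈ D ∧ Ω u v = 1) a b

/-- The vectors of `D` orthogonal to `a` and not congruent to `a` modulo the kernel. -/
def localSet (Ω : BForm V) (D : Set V) (a : V) : Set V :=
  {b | b ∈ D ∧ Ω a b = 0 ∧ ∃ z ∈ D, Ω (a + b) z = 1}

/-- Orbit equivalence under the transvections in elements of `D`. -/
def TransRel (Ω : BForm V) (D : Set V) : V → V → Prop :=
  Relation.ReflTransGen fun u v => ∃ e ∈ D, Ω u e = 1 ∧ v = u + e

section
variable {Ω : BForm V} {D : Set V}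

lemma IsVanishing.common_neighbor (hΩ : ∀ x, Ω x x = 0) (hD : IsVanishing Ω D) {a b : V}
    (ha : a ∈ D) (hb : b ∈ D) (hne : a ≠ b) (hab : Ω a b = 0) :
    ∃ z ∈ D, Ω z a = 1 ∧ Ω z b = 1 := by
  have sym := alternating_symm Ω hΩ
  have key : a = b ∨ Ω a b = 1 ∨ ∃ z ∈ D, Ω z a = 1 ∧ Ω z b = 1 := by
    have hp := hD.conn a ha b hb
    suffices b ∈ D ∧ (a = b ∨ Ω a b = 1 ∨ ∃ z ∈ D, Ω z a = 1 ∧ Ω z b = 1) from this.2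
    clear hne hab hb
    induction hp with
    | refl => exact ⟨ha, Or.inl rfl⟩
    | @tail b c _ hbc ih =>
      refine ⟨hbc.1, ?_⟩
      obtain ⟨hb, rfl | h | ⟨z, hz, hza, hzb⟩⟩ := ih
      · exact Or.inr (Or.inl hbc.2)
      · exact Or.inr (Or.inr ⟨b, hb, by rw [sym]; exact h, hbc.2⟩)
      · rcases zmod_two_cases (Ω z c) with hzc | hzc
        · rcases zmod_two_cases (Ω b a) with hba | hba
          · refine Or.inr (Or.inr ⟨z + b, hD.add_mem z hz b hb hzb, ?_, ?_⟩)
            · simp [hza, hba]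
            · simp [hzc, hbc.2]
          · exact Or.inr (Or.inr ⟨b, hb, hba, hbc.2⟩)
        · exact Or.inr (Or.inr ⟨z, hz, hza, hzc⟩)
  rcases key with h | h | h
  · exact absurd h hne
  · simp [h] at hab
  · exact h

/-- Three pairwise orthogonal elements with a common neighbor sum to an element of `D`. -/
lemma IsVanishing.add_add_mem (hΩ : ∀ x, Ω x x = 0) (hD : IsVanishing Ω D) {a b c z : V}
    (ha : a ∈ D) (hb : b ∈ D) (hc : c ∈ D) (hz : z ∈ D)
    (hab : Ω a b = 0) (hac : Ω a c = 0) (hbc : Ω b c = 0)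
    (hza : Ω z a = 1) (hzb : Ω z b = 1) (hzc : Ω z c = 1) : a + b + c ∈ D := by
  have sym := alternating_symm Ω hΩ
  have haz : Ω a z = 1 := by rw [sym, hza]
  have hbz : Ω b z = 1 := by rw [sym, hzb]
  have hcz : Ω c z = 1 := by rw [sym, hzc]
  have h₁ := hD.add_mem z hz a ha hza
  have h₂ := hD.add_mem _ h₁ b hb (by simp [hzb, hab])
  have h₃ := hD.add_mem _ h₂ c hc (by simp [hzc, hac, hbc])
  have h₄ := hD.add_mem _ h₃ z hz (by simp [hΩ, haz, hbz, hcz]; decide)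
  have : z + a + b + c + z = a + b + c + (z + z) := by abel
  rwa [this, add_self_zmod_two, add_zero] at h₄

/-- An element `b` of the local set of `a` lies on a path `a, z, b, w` with `w` orthogonal
to `a`. -/
lemma IsVanishing.exists_path (hΩ : ∀ x, Ω x x = 0) (hD : IsVanishing Ω D) {a b : V}
    (ha : a ∈ D) (hb : b ∈ localSet Ω D a) :
    ∃ z ∈ D, ∃ w ∈ D, Ω z a = 1 ∧ Ω z b = 1 ∧ Ω w b = 1 ∧ Ω w a = 0 := by
  have sym := alternating_symm Ω hΩ
  obtain ⟨hbD, hab, u, hu, hau⟩ := hb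
  have hne : a ≠ b := by
    rintro rfl
    simp [add_self_zmod_two] at hau
  have hba : Ω b a = 0 := by rw [sym, hab]
  obtain ⟨z, hz, hza, hzb⟩ := hD.common_neighbor hΩ ha hbD hne hab
  rw [map_add, LinearMap.add_apply] at hau
  rcases zmod_two_cases (Ω a u) with h | h
  · have hbu : Ω b u = 1 := by simpa [h] using hau
    have hub : Ω u b = 1 := by rw [sym, hbu]
    have hua : Ω u a = 0 := by rw [sym, h]
    exact ⟨z, hz, u, hu, hza, hzb, hub, hua⟩
  · have hbu : Ω b u = 0 := by simpa [h] using hau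
    have hub : Ω u b = 0 := by rw [sym, hbu]
    have hua : Ω u a = 1 := by rw [sym, h]
    obtain ⟨z, hz, hza, hzb, hzu⟩ : ∃ z ∈ D, Ω z a = 1 ∧ Ω z b = 1 ∧ Ω z u = 0 := by
      rcases zmod_two_cases (Ω z u) with hzu | hzu
      · exact ⟨z, hz, hza, hzb, hzu⟩
      · refine ⟨z + a, hD.add_mem z hz a ha hza, ?_, ?_, ?_⟩
        · simp [hza, hΩ]
        · simp [hzb, hab]
        · simp [hzu, h]; decide
    have haz : Ω a z = 1 := by rw [sym, hza]
    have huz : Ω u z = 0 := by rw [sym, hzu]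
    have h₁ := hD.add_mem u hu a ha hua
    have h₂ := hD.add_mem _ h₁ z hz (by simp [huz, haz])
    have h₃ := hD.add_mem _ h₂ b hbD (by simp [hub, hab, hzb])
    refine ⟨z, hz, _, h₃, hza, hzb, ?_, ?_⟩
    · simp [hub, hab, hzb, hΩ]
    · simp [hua, hza, hba, hΩ]; decide

/-- Orthogonal neighbors of elements of the local set stay in the local set. -/
lemma mem_localSet_of_adj {a u v : V} (hΩ : ∀ x, Ω x x = 0) (hu : u ∈ localSet Ω D a)
    (hv : v ∈ D) (hav : Ω a v = 0) (huv : Ω u v = 1) : v ∈ localSet Ω D a :=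
  ⟨hv, hav, u, hu.1, by simp [hu.2.1, alternating_symm Ω hΩ v u, huv]⟩

/-- Two orthogonal elements not linked inside the complement of `a` have no common neighbor
that is adjacent to `a`. -/
lemma IsVanishing.not_adj_of_separated (hΩ : ∀ x, Ω x x = 0) (hD : IsVanishing Ω D)
    {a b c z w w' : V} (ha : a ∈ D) (hb : b ∈ D) (hc : c ∈ D) (hz : z ∈ D)
    (hab : Ω a b = 0) (hac : Ω a c = 0) (hbc : Ω b c = 0) (hza : Ω z a = 1) (hzb : Ω z b = 1)
    (hwb : Ω w b = 1) (hwa : Ω w a = 0) (hw'c : Ω w' c = 1) (hw'a : Ω w' a = 0)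
    (hbw' : Ω w' b = 0) (hcw : Ω w c = 0)
    (hsep : ∀ e ∈ D, Ω a e = 0 → Ω w e = 1 → Ω w' e = 1 → False) : Ω z c = 0 := by
  have sym := alternating_symm Ω hΩ
  refine (zmod_two_cases (Ω z c)).resolve_right fun hzc => ?_
  refine hsep (a + b + c) (hD.add_add_mem hΩ ha hb hc hz hab hac hbc hza hzb hzc) ?_ ?_ ?_
  · simp [hΩ, hab, hac]
  · simp [hwa, hwb, hcw]
  · simp [hw'a, hbw', hw'c]

/-- The local set of an element of a vanishing set is again a vanishing set. -/
lemma IsVanishing.localSet (hΩ : ∀ x, Ω x x = 0) (hD : IsVanishing Ω D) {a : V} (ha : a ∈ D) :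
    IsVanishing Ω (localSet Ω D a) := by
  have sym := alternating_symm Ω hΩ
  refine ⟨fun u hu v hv huv => ⟨hD.add_mem u hu.1 v hv.1 huv, ?_, u, hu.1, ?_⟩, ?_⟩
  · simp [hu.2.1, hv.2.1]
  · simp [hu.2.1, hΩ, sym v u, huv]
  intro b hb c hc
  by_contra hnot
  set R := Relation.ReflTransGen fun u v => v ∈ _root_.localSet Ω D a ∧ Ω u v = 1
  have orth : ∀ p ∈ _root_.localSet Ω D a, ∀ q ∈ _root_.localSet Ω D a, R b p → R q c →
      Ω p q = 0 := fun p hp q hq hbp hqc =>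
    (zmod_two_cases _).resolve_right fun h => hnot ((hbp.tail ⟨hq, h⟩).trans hqc)
  have sep : ∀ p ∈ _root_.localSet Ω D a, ∀ q ∈ _root_.localSet Ω D a, R b p → R q c →
      ∀ e ∈ D, Ω a e = 0 → Ω p e = 1 → Ω q e = 1 → False := by
    intro p hp q hq hbp hqc e he hae hpe hqe
    have heL := mem_localSet_of_adj hΩ hp he hae hpe
    have := orth e heL q hq (hbp.tail ⟨heL, hpe⟩) hqc
    rw [sym, hqe] at this
    simp at this
  obtain ⟨z, hz, w, hw, hza, hzb, hwb, hwa⟩ := hD.exists_path hΩ ha hb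
  obtain ⟨z', hz', w', hw', hza', hzc', hwc', hwa'⟩ := hD.exists_path hΩ ha hc
  have hwL := mem_localSet_of_adj hΩ hb hw (by rw [sym, hwa]) (by rw [sym, hwb])
  have hwL' := mem_localSet_of_adj hΩ hc hw' (by rw [sym, hwa']) (by rw [sym, hwc'])
  have hbw : R b w := .single ⟨hwL, by rw [sym, hwb]⟩
  have hwc : R w' c := .single ⟨hc, hwc'⟩
  have hbc := orth b hb c hc .refl .refl
  have hwc0 := orth w hwL c hc hbw .refl
  have hbw'0 := orth b hb w' hwL' .refl hwc
  have hsep := sep w hwL w' hwL' hbw hwc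
  have hzc : Ω z c = 0 := hD.not_adj_of_separated hΩ ha hb.1 hc.1 hz hb.2.1 hc.2.1 hbc
    hza hzb hwb hwa hwc' hwa' (by rw [sym, hbw'0]) hwc0 hsep
  have hzb' : Ω z' b = 0 := hD.not_adj_of_separated hΩ ha hc.1 hb.1 hz' hc.2.1 hb.2.1
    (by rw [sym, hbc]) hza' hzc' hwc' hwa' hwb hwa hwc0 (by rw [sym, hbw'0])
    (fun e he h₁ h₂ h₃ => hsep e he h₁ h₃ h₂)
  have hsep := sep b hb c hc .refl .refl
  have haz : Ω a z = 1 := by rw [sym, hza]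
  have haz' : Ω a z' = 1 := by rw [sym, hza']
  have hba : Ω b a = 0 := by rw [sym, hb.2.1]
  have hca : Ω c a = 0 := by rw [sym, hc.2.1]
  rw [sym] at hzb hzc' hzb' hzc
  rcases zmod_two_cases (Ω z z') with h | h
  · refine hsep (z + a + z') (hD.add_mem _ (hD.add_mem z hz a ha hza) z' hz' ?_) ?_ ?_ ?_
    · simp [h, haz']
    · simp [haz, haz', hΩ]; decide
    · simp [hzb, hba, hzb']
    · simp [hzc, hca, hzc']
  · refine hsep (z + z') (hD.add_mem z hz z' hz' h) ?_ ?_ ?_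
    · simp [haz, haz']; decide
    · simp [hzb, hzb']
    · simp [hzc, hzc']

end

/-- `m` consists of elements of `D`, and no shorter family in `D` has the same sum. -/
def IsMinRep {M : Type*} [AddCommMonoid M] (D : Set M) (m : Multiset M) : Prop :=
  (∀ a ∈ m, a ∈ D) ∧ ∀ m' : Multiset M, (∀ a ∈ m', a ∈ D) → m'.sum = m.sum →
    m.card ≤ m'.card

lemma exists_isMinRep {M : Type*} [AddCommMonoid M] {D : Set M} {x : M}
    (h : ∃ m : Multiset M, (∀ a ∈ m, a ∈ D) ∧ m.sum = x) :
    ∃ m : Multiset M, IsMinRep D m ∧ m.sum = x := by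
  obtain ⟨m₀, hm₀, hmin⟩ := WellFounded.has_min (measure Multiset.card).wf
    {m : Multiset M | (∀ a ∈ m, a ∈ D) ∧ m.sum = x} h
  exact ⟨m₀, ⟨hm₀.1, fun m' hm' hs => not_lt.mp (hmin m' ⟨hm', hs.trans hm₀.2⟩)⟩, hm₀.2⟩

section
variable {Ω : BForm V} {D : Set V}

lemma IsMinRep.orthogonal (hD : IsVanishing Ω D) {a b : V} {t : Multiset V}
    (hm : IsMinRep D (a ::ₘ b ::ₘ t)) : Ω a b = 0 := by
  obtain ⟨hmem, hmin⟩ := hm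
  simp only [Multiset.forall_mem_cons] at hmem
  obtain ⟨ha, hb, ht⟩ := hmem
  refine (zmod_two_cases _).resolve_right fun h => ?_
  have := hmin ((a + b) ::ₘ t)
    (by simpa only [Multiset.forall_mem_cons] using ⟨hD.add_mem a ha b hb h, ht⟩)
    (by simp [add_assoc])
  simp at this

lemma IsMinRep.no_common_neighbor (hΩ : ∀ x, Ω x x = 0) (hD : IsVanishing Ω D) {a b c z : V}
    {t : Multiset V} (hm : IsMinRep D (a ::ₘ b ::ₘ c ::ₘ t)) (hz : z ∈ D) (hza : Ω z a = 1)
    (hzb : Ω z b = 1) (hzc : Ω z c = 1) : False := by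
  have hab := hm.orthogonal hD
  have hac : Ω a c = 0 := by
    rw [Multiset.cons_swap b c t] at hm
    exact hm.orthogonal hD
  have hbc : Ω b c = 0 := by
    rw [Multiset.cons_swap a b, Multiset.cons_swap a c t] at hm
    exact hm.orthogonal hD
  obtain ⟨hmem, hmin⟩ := hm
  simp only [Multiset.forall_mem_cons] at hmem
  obtain ⟨ha, hb, hc, ht⟩ := hmem
  have h := hD.add_add_mem hΩ ha hb hc hz hab hac hbc hza hzb hzc
  have := hmin ((a + b + c) ::ₘ t)
    (by simpa only [Multiset.forall_mem_cons] using ⟨h, ht⟩) (by simp [add_assoc])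
  simp at this

lemma exists_apply_eq_one_of_sum {z : V} {t : Multiset V} (h : Ω t.sum z = 1) :
    ∃ c ∈ t, Ω c z = 1 := by
  by_contra! hne
  have h₀ : Ω.flip z t.sum = 0 := by
    rw [map_multiset_sum]
    refine Multiset.sum_eq_zero fun x hx => ?_
    obtain ⟨c, hc, rfl⟩ := Multiset.mem_map.mp hx
    exact (zmod_two_cases _).resolve_right (hne c hc)
  rw [LinearMap.flip_apply, h] at h₀
  simp at h₀

/-- A minimal representation of a vector not orthogonal to `z` has a member orthogonal to `z`. -/
lemma IsMinRep.exists_orthogonal_mem (hΩ : ∀ x, Ω x x = 0) (hD : IsVanishing Ω D) {z : V}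
    {m : Multiset V} (hm : IsMinRep D m) (hz : z ∈ D) (hmz : Ω m.sum z = 1)
    (hcard : 2 ≤ m.card) : ∃ a ∈ m, Ω a z = 0 := by
  by_contra! hne
  have hone : ∀ a ∈ m, Ω z a = 1 := fun a ha => by
    rw [alternating_symm Ω hΩ]
    exact (zmod_two_cases _).resolve_left (hne a ha)
  obtain ⟨a, m, rfl⟩ : ∃ a t, m = a ::ₘ t := by
    obtain ⟨a, ha⟩ := Multiset.card_pos_iff_exists_mem.mp (by omega : 0 < m.card)
    exact ⟨a, Multiset.exists_cons_of_mem ha⟩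
  rw [Multiset.card_cons] at hcard
  obtain ⟨b, m, rfl⟩ : ∃ a t, m = a ::ₘ t := by
    obtain ⟨a, ha⟩ := Multiset.card_pos_iff_exists_mem.mp (by omega : 0 < m.card)
    exact ⟨a, Multiset.exists_cons_of_mem ha⟩
  rcases m.empty_or_exists_mem with rfl | ⟨c, hc⟩
  · have ha := hone a (by simp)
    have hb := hone b (by simp)
    rw [alternating_symm Ω hΩ] at hmz
    simp [ha, hb] at hmz
  · obtain ⟨t, rfl⟩ := Multiset.exists_cons_of_mem hc
    exact hm.no_common_neighbor hΩ hD hz (hone a (by simp)) (hone b (by simp))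
      (hone c (by simp))

/-- Splitting off a member of a minimal representation that is orthogonal to `z`. -/
lemma IsMinRep.tail (hΩ : ∀ x, Ω x x = 0) (hD : IsVanishing Ω D) {a z : V}
    {t : Multiset V} (hm : IsMinRep D (a ::ₘ t)) (hz : z ∈ D) (haz : Ω a z = 0)
    (htz : Ω t.sum z = 1) : IsMinRep (localSet Ω D a) t ∧ z ∈ localSet Ω D a := by
  have sym := alternating_symm Ω hΩ
  have ha : a ∈ D := hm.1 a (by simp)
  refine ⟨⟨fun c hc => ?_, fun m' hm' hsum => ?_⟩, hz, haz, ?_⟩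
  · obtain ⟨t, rfl⟩ := Multiset.exists_cons_of_mem hc
    have hcD : c ∈ D := hm.1 c (by simp)
    have hac := hm.orthogonal hD
    refine ⟨hcD, hac, ?_⟩
    rcases t.empty_or_exists_mem with rfl | ⟨e, he⟩
    · exact ⟨z, hz, by simpa [haz] using htz⟩
    · obtain ⟨t, rfl⟩ := Multiset.exists_cons_of_mem he
      have heD : e ∈ D := hm.1 e (by simp)
      have hce : Ω a e = 0 := by
        rw [Multiset.cons_swap c e t] at hm
        exact hm.orthogonal hD
      have hne : a ≠ e := by
        rintro rfl
        have := hm.2 (c ::ₘ t) (fun x hx => hm.1 x (by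
          simp only [Multiset.mem_cons] at hx ⊢
          tauto)) (by
            have : a + (c + (a + t.sum)) = a + a + (c + t.sum) := by abel
            simp [this, add_self_zmod_two])
        simp at this
      obtain ⟨y, hy, hya, hye⟩ := hD.common_neighbor hΩ ha heD hne hce
      refine ⟨y, hy, ?_⟩
      rw [map_add, LinearMap.add_apply, sym a, sym c, hya,
        (zmod_two_cases (Ω y c)).resolve_right fun hyc =>
          hm.no_common_neighbor hΩ hD hy hya hyc hye, add_zero]
  · have := hm.2 (a ::ₘ m')
      (by simpa only [Multiset.forall_mem_cons] using ⟨ha, fun x hx => (hm' x hx).1⟩)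
      (by simp [hsum])
    simpa using this
  · obtain ⟨c, hc, hcz⟩ := exists_apply_eq_one_of_sum htz
    obtain ⟨t, rfl⟩ := Multiset.exists_cons_of_mem hc
    exact ⟨c, hm.1 c (by simp), by simp [hm.orthogonal hD, sym z c, hcz]⟩

/-- The transvection `x ↦ x + Ω(x,e) e` as a linear automorphism. -/
def transvectionEquiv (Ω : BForm V) (hΩ : ∀ x, Ω x x = 0) (e : V) : V ≃ₗ[ZMod 2] V :=
  LinearEquiv.ofInvolutive (LinearMap.id + (Ω.flip e).smulRight e) fun x => by
    simp [hΩ, add_assoc, add_self_zmod_two]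

lemma transvectionEquiv_apply (hΩ : ∀ x, Ω x x = 0) (e x : V) :
    transvectionEquiv Ω hΩ e x = x + Ω x e • e := rfl

lemma transvectionEquiv_isometry (hΩ : ∀ x, Ω x x = 0) (e x y : V) :
    Ω (transvectionEquiv Ω hΩ e x) (transvectionEquiv Ω hΩ e y) = Ω x y := by
  simp only [transvectionEquiv_apply, map_add, map_smul, LinearMap.add_apply,
    LinearMap.smul_apply, hΩ, smul_eq_mul, alternating_symm Ω hΩ e y]
  generalize Ω x y = p
  generalize Ω x e = q
  generalize Ω y e = r
  revert p q r
  decide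

lemma TransRel.transvectionEquiv (hΩ : ∀ x, Ω x x = 0) {e : V} (he : e ∈ D) (u : V) :
    TransRel Ω D u (transvectionEquiv Ω hΩ e u) := by
  rw [transvectionEquiv_apply]
  rcases zmod_two_cases (Ω u e) with h | h
  · rw [h, zero_smul, add_zero]
    exact .refl
  · rw [h, one_smul]
    exact .single ⟨e, he, h, rfl⟩

lemma IsVanishing.transvectionEquiv_mem (hΩ : ∀ x, Ω x x = 0) (hD : IsVanishing Ω D) {e u : V}
    (he : e ∈ D) (hu : u ∈ D) : _root_.transvectionEquiv Ω hΩ e u ∈ D := by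
  rw [transvectionEquiv_apply]
  rcases zmod_two_cases (Ω u e) with h | h
  · rwa [h, zero_smul, add_zero]
  · rw [h, one_smul]
    exact hD.add_mem u hu e he h

lemma TransRel.symm (hΩ : ∀ x, Ω x x = 0) {x y : V} (h : TransRel Ω D x y) :
    TransRel Ω D y x := by
  have hs : Std.Symm fun u v => ∃ e ∈ D, Ω u e = 1 ∧ v = u + e := ⟨by
    rintro u _ ⟨e, he, hue, rfl⟩
    exact ⟨e, he, by simp [hue, hΩ], by rw [add_assoc, add_self_zmod_two, add_zero]⟩⟩
  exact Relation.ReflTransGen.stdSymm.symm _ _ h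

lemma IsVanishing.transRel (hΩ : ∀ x, Ω x x = 0) (hD : IsVanishing Ω D) {x y : V} (hx : x ∈ D)
    (hy : y ∈ D) : TransRel Ω D x y := by
  suffices y ∈ D ∧ TransRel Ω D x y from this.2
  have h := hD.conn x hx y hy
  clear hy
  induction h with
  | refl => exact ⟨hx, .refl⟩
  | @tail u v _ huv ih =>
    refine ⟨huv.1, (ih.2.tail ⟨v, huv.1, huv.2, rfl⟩).tail ⟨u, ih.1, ?_, ?_⟩⟩
    · simp [hΩ, alternating_symm Ω hΩ v u, huv.2]
    · rw [add_right_comm, add_self_zmod_two, zero_add]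

/-- Orbit equivalence is realised by an isometry preserving `D`. -/
lemma TransRel.exists_isometry (hΩ : ∀ x, Ω x x = 0) (hD : IsVanishing Ω D) {x y : V}
    (h : TransRel Ω D x y) : ∃ g : V ≃ₗ[ZMod 2] V, g x = y ∧ (∀ u v, Ω (g u) (g v) = Ω u v) ∧
      (∀ u, g u ∈ D ↔ u ∈ D) ∧ ∀ u, TransRel Ω D u (g u) := by
  induction h with
  | refl => exact ⟨LinearEquiv.refl _ _, rfl, fun _ _ => rfl, fun _ => Iff.rfl, fun _ => .refl⟩
  | tail _ hstep ih =>
    obtain ⟨g, rfl, hg, hgD, hgr⟩ := ih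
    obtain ⟨e, he, hue, rfl⟩ := hstep
    refine ⟨g.trans (_root_.transvectionEquiv Ω hΩ e), ?_, fun u v => ?_, fun u => ?_, fun u => ?_⟩
    · simp [transvectionEquiv_apply, hue]
    · simp [transvectionEquiv_isometry, hg]
    · rw [← hgD u, LinearEquiv.trans_apply]
      refine ⟨fun h => ?_, hD.transvectionEquiv_mem hΩ he⟩
      have := hD.transvectionEquiv_mem hΩ he h
      rw [transvectionEquiv_apply, transvectionEquiv_apply] at this
      simpa [hΩ, add_assoc, add_self_zmod_two] using this
    · exact (hgr u).trans (TransRel.transvectionEquiv hΩ he _)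

lemma IsMinRep.map {g : V ≃ₗ[ZMod 2] V} (hg : ∀ u, g u ∈ D ↔ u ∈ D) {m : Multiset V}
    (hm : IsMinRep D m) : IsMinRep D (m.map g) := by
  refine ⟨fun a ha => ?_, fun m' hm' hsum => ?_⟩
  · obtain ⟨u, hu, rfl⟩ := Multiset.mem_map.mp ha
    exact (hg u).mpr (hm.1 u hu)
  · have := hm.2 (m'.map g.symm) (fun a ha => by
      obtain ⟨u, hu, rfl⟩ := Multiset.mem_map.mp ha
      rw [← hg, LinearEquiv.apply_symm_apply]
      exact hm' u hu) (by
        rw [← map_multiset_sum, hsum, ← map_multiset_sum, LinearEquiv.symm_apply_apply])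
    simpa using this

lemma TransRel.add_left {a x y : V} (h : TransRel Ω (localSet Ω D a) x y) :
    TransRel Ω D (a + x) (a + y) := by
  refine Relation.ReflTransGen.lift (a + ·) ?_ _ _ h
  rintro u _ ⟨e, he, hue, rfl⟩
  exact ⟨e, he.1, by simp [he.2.1, hue], by rw [add_assoc]⟩

/-- Vectors not orthogonal to `D` with minimal representations of equal length are
orbit equivalent. -/
theorem IsMinRep.transRel (hΩ : ∀ x, Ω x x = 0) (n : ℕ) : ∀ {D : Set V}, IsVanishing Ω D →
    ∀ {m m' : Multiset V}, IsMinRep D m → IsMinRep D m' → m.card = n → m'.card = n →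
    (∃ z ∈ D, Ω m.sum z = 1) → (∃ z ∈ D, Ω m'.sum z = 1) → TransRel Ω D m.sum m'.sum := by
  induction n with
  | zero =>
    rintro D - m m' - - hc - ⟨z, -, hz⟩ -
    simp [Multiset.card_eq_zero.mp hc] at hz
  | succ n ih =>
    rintro D hD m m' hm hm' hc hc' ⟨z, hz, hmz⟩ ⟨z', hz', hmz'⟩
    rcases Nat.eq_zero_or_pos n with rfl | hn
    · obtain ⟨a, rfl⟩ := Multiset.card_eq_one.mp hc
      obtain ⟨b, rfl⟩ := Multiset.card_eq_one.mp hc'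
      simpa using hD.transRel hΩ (hm.1 a (by simp)) (hm'.1 b (by simp))
    obtain ⟨a, ha, haz⟩ := hm.exists_orthogonal_mem hΩ hD hz hmz (by omega)
    obtain ⟨b, hb, hbz⟩ := hm'.exists_orthogonal_mem hΩ hD hz' hmz' (by omega)
    obtain ⟨t, rfl⟩ := Multiset.exists_cons_of_mem ha
    obtain ⟨t', rfl⟩ := Multiset.exists_cons_of_mem hb
    have haD : a ∈ D := hm.1 a ha
    obtain ⟨g, rfl, hg, hgD, hgr⟩ :=
      (hD.transRel hΩ (hm'.1 b hb) haD).exists_isometry hΩ hD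
    rw [Multiset.sum_cons, map_add, LinearMap.add_apply] at hmz hmz'
    rw [haz, zero_add] at hmz
    rw [hbz, zero_add] at hmz'
    have hgm := hm'.map hgD
    rw [Multiset.map_cons] at hgm
    obtain ⟨ht, hzL⟩ := hm.tail hΩ hD hz haz hmz
    have hgz : Ω (t'.map g).sum (g z') = 1 := by rw [← map_multiset_sum, hg, hmz']
    obtain ⟨ht', hzL'⟩ := hgm.tail hΩ hD ((hgD z').mpr hz') (by rw [hg, hbz]) hgz
    have key := (ih (hD.localSet hΩ haD) ht ht' (by simpa using hc) (by simpa using hc')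
      ⟨z, hzL, hmz⟩ ⟨g z', hzL', hgz⟩).add_left
    rw [← map_multiset_sum, ← map_add] at key
    rw [Multiset.sum_cons, Multiset.sum_cons]
    exact key.trans ((hgr _).symm hΩ)

end

section
variable {Ω : BForm V} {B : Set V}

lemma Gamma.isometry (hΩ : ∀ x, Ω x x = 0) {g : V ≃ₗ[ZMod 2] V} (hg : g ∈ Gamma Ω B) (u v : V) :
    Ω (g u) (g v) = Ω u v := by
  induction hg using Subgroup.closure_induction generalizing u v with
  | mem g hg =>
    obtain ⟨b, -, h⟩ := hg
    rw [h, h, ← transvectionEquiv_apply hΩ, ← transvectionEquiv_apply hΩ,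
      transvectionEquiv_isometry]
  | one => rfl
  | mul g h _ _ ihg ihh => rw [LinearEquiv.mul_apply, LinearEquiv.mul_apply, ihg, ihh]
  | inv g _ ih =>
    rw [← ih, ← LinearEquiv.mul_apply, ← LinearEquiv.mul_apply, mul_inv_cancel]
    rfl

lemma Gamma.map_mem_delta {g : V ≃ₗ[ZMod 2] V} (hg : g ∈ Gamma Ω B) {u : V}
    (hu : u ∈ Delta Ω B) : g u ∈ Delta Ω B := by
  obtain ⟨b, hb, h, hh, rfl⟩ := hu
  exact ⟨b, hb, g * h, mul_mem hg hh, rfl⟩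

lemma mem_delta_of_mem {b : V} (hb : b ∈ B) : b ∈ Delta Ω B :=
  ⟨b, hb, 1, one_mem _, rfl⟩

lemma transvectionEquiv_mem_gamma (hΩ : ∀ x, Ω x x = 0) {e : V} (he : e ∈ Delta Ω B) :
    transvectionEquiv Ω hΩ e ∈ Gamma Ω B := by
  obtain ⟨b, hb, g, hg, rfl⟩ := he
  have hτ : transvectionEquiv Ω hΩ b ∈ Gamma Ω B :=
    Subgroup.subset_closure ⟨b, hb, transvectionEquiv_apply hΩ b⟩
  have : transvectionEquiv Ω hΩ (g b) = g * transvectionEquiv Ω hΩ b * g⁻¹ := by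
    ext x
    have hx : g (g⁻¹ x) = x := g.apply_symm_apply x
    rw [LinearEquiv.mul_apply, LinearEquiv.mul_apply, transvectionEquiv_apply,
      transvectionEquiv_apply, map_add, map_smul, hx, ← Gamma.isometry hΩ hg (g⁻¹ x) b, hx]
  rw [this]
  exact mul_mem (mul_mem hg hτ) (inv_mem hg)

lemma SameOrbit.of_transRel (hΩ : ∀ x, Ω x x = 0) {x y : V}
    (h : TransRel Ω (Delta Ω B) x y) : SameOrbit Ω B x y := by
  induction h with
  | refl => exact ⟨1, one_mem _, rfl⟩
  | tail _ hstep ih =>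
    obtain ⟨g, hg, rfl⟩ := ih
    obtain ⟨e, he, hue, rfl⟩ := hstep
    exact ⟨transvectionEquiv Ω hΩ e * g, mul_mem (transvectionEquiv_mem_gamma hΩ he) hg,
      by rw [LinearEquiv.mul_apply, transvectionEquiv_apply, hue, one_smul]⟩

/-- The orbit of a connected set is a vanishing set. -/
lemma isVanishing_delta (hΩ : ∀ x, Ω x x = 0) (hconn : (Gr Ω B).Connected) :
    IsVanishing Ω (Delta Ω B) := by
  have sym := alternating_symm Ω hΩ
  let r : V → V → Prop := fun u v => u ∈ Delta Ω B ∧ v ∈ Delta Ω B ∧ Ω u v = 1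
  have hr : Std.Symm r := ⟨fun u v h => ⟨h.2.1, h.1, by rw [sym, h.2.2]⟩⟩
  have hrs : ∀ {u v}, Relation.ReflTransGen r u v → Relation.ReflTransGen r v u :=
    fun h => Relation.ReflTransGen.stdSymm.symm _ _ h
  have hBB : ∀ b c : B, Relation.ReflTransGen r b.1 c.1 := fun b c => by
    have h := ((Gr Ω B).reachable_iff_reflTransGen b c).mp (hconn.preconnected b c)
    refine Relation.ReflTransGen.lift Subtype.val ?_ _ _ h
    intro u v huv
    refine ⟨mem_delta_of_mem u.2, mem_delta_of_mem v.2, ?_⟩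
    rcases ((SimpleGraph.fromRel_adj _ _ _).mp huv).2 with h | h
    · exact h
    · rw [sym, h]
  have hΓ : ∀ g ∈ Gamma Ω B, ∀ u ∈ Delta Ω B, Relation.ReflTransGen r u (g u) := by
    intro g hg
    induction hg using Subgroup.closure_induction with
    | mem g hg =>
      intro u hu
      obtain ⟨b, hb, h⟩ := id hg
      rcases zmod_two_cases (Ω u b) with hub | hub
      · rw [h, hub, zero_smul, add_zero]
      · have hgu := Gamma.map_mem_delta (Subgroup.subset_closure hg) hu
        have hbD := mem_delta_of_mem (Ω := Ω) hb
        rw [h, hub, one_smul] at hgu ⊢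
        have hub' : r u b := ⟨hu, hbD, hub⟩
        have hbu' : r b (u + b) := ⟨hbD, hgu, by rw [map_add, hΩ, add_zero, sym, hub]⟩
        exact .tail (.single hub') hbu'
    | one => exact fun u _ => .refl
    | mul g h _ hh ihg ihh =>
      exact fun u hu => (ihh u hu).trans (ihg _ (Gamma.map_mem_delta hh hu))
    | inv g hg ih =>
      intro u hu
      have := ih _ (Gamma.map_mem_delta (inv_mem hg) hu)
      rw [← LinearEquiv.mul_apply, mul_inv_cancel] at this
      exact hrs this
  refine ⟨fun a ha b hb hab => ?_, fun a ha b hb => ?_⟩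
  · have := Gamma.map_mem_delta (transvectionEquiv_mem_gamma hΩ hb) ha
    rwa [transvectionEquiv_apply, hab, one_smul] at this
  · obtain ⟨p, hp, g, hg, rfl⟩ := ha
    obtain ⟨q, hq, h, hh, rfl⟩ := hb
    have hpath := (hrs (hΓ g hg p (mem_delta_of_mem hp))).trans
      ((hBB ⟨p, hp⟩ ⟨q, hq⟩).trans (hΓ h hh q (mem_delta_of_mem hq)))
    exact Relation.ReflTransGen.mono (fun u v huv => huv.2) _ _ hpath

lemma exists_multiset_sum_eq (hB : IsBasisSet B) (x : V) :
    ∃ m : Multiset V, (∀ a ∈ m, a ∈ Delta Ω B) ∧ m.sum = x := by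
  have hx : x ∈ Submodule.span (ZMod 2) B := by rw [hB.2]; trivial
  induction hx using Submodule.span_induction with
  | mem b hb => exact ⟨{b}, by simpa using mem_delta_of_mem hb, by simp⟩
  | zero => exact ⟨0, by simp, by simp⟩
  | add u v _ _ hu hv =>
    obtain ⟨m, hm, rfl⟩ := hu
    obtain ⟨m', hm', rfl⟩ := hv
    exact ⟨m + m', fun a ha => (Multiset.mem_add.mp ha).elim (hm a) (hm' a), by simp⟩
  | smul t u _ hu =>
    rcases zmod_two_cases t with rfl | rfl
    · exact ⟨0, by simp, by simp⟩
    · simpa using hu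

lemma IsMinRep.hasDeltaDecomp (hΩ : ∀ x, Ω x x = 0) (hD : IsVanishing Ω (Delta Ω B))
    {m : Multiset V} (hm : IsMinRep (Delta Ω B) m) (h0 : m.sum ≠ 0) :
    HasDeltaDecomp Ω B m.sum m.card := by
  induction m using Quotient.inductionOn with | _ l
  simp only [Multiset.quot_mk_to_coe, Multiset.sum_coe, Multiset.coe_card] at *
  have hpair : l.Pairwise fun a b => Ω a b = 0 := by
    refine List.pairwise_iff_forall_sublist.mpr fun {a b} hab => ?_
    obtain ⟨t, ht⟩ := Multiset.le_iff_exists_add.mp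
      (Multiset.coe_le.mpr hab.subperm)
    rw [ht, show ((([a, b] : List V) : Multiset V) + t) = a ::ₘ b ::ₘ t from by
      rw [← Multiset.cons_coe, ← Multiset.cons_coe, Multiset.cons_add, Multiset.cons_add,
        Multiset.coe_nil, zero_add]] at hm
    exact hm.orthogonal hD
  rw [List.pairwise_iff_get] at hpair
  refine ⟨?_, l.get, fun i => hm.1 _ (by simp), fun i j hij => ?_, ?_⟩
  · rcases l with _ | ⟨a, l⟩
    · simp at h0
    · simp
  · rcases lt_or_gt_of_ne hij with h | h
    · exact hpair i j h
    · rw [alternating_symm Ω hΩ]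
      exact hpair j i h
  · rw [← List.sum_ofFn, List.ofFn_get]

lemma IsMinRep.dval_eq (hΩ : ∀ x, Ω x x = 0) (hD : IsVanishing Ω (Delta Ω B))
    {m : Multiset V} (hm : IsMinRep (Delta Ω B) m) (h0 : m.sum ≠ 0) :
    dval Ω B m.sum = m.card := by
  have h := hm.hasDeltaDecomp hΩ hD h0
  refine le_antisymm (Nat.sInf_le h) (le_csInf ⟨_, h⟩ ?_)
  rintro s ⟨-, f, hf, -, hsum⟩
  have := hm.2 (Finset.univ.val.map f) (fun a ha => by
    obtain ⟨i, -, rfl⟩ := Multiset.mem_map.mp ha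
    exact hf i) hsum.symm
  simpa using this

lemma SameOrbit.symm {x y : V} (h : SameOrbit Ω B x y) : SameOrbit Ω B y x := by
  obtain ⟨g, hg, rfl⟩ := h
  exact ⟨g⁻¹, inv_mem hg, g.symm_apply_apply x⟩

lemma HasDeltaDecomp.of_sameOrbit (hΩ : ∀ x, Ω x x = 0) {x y : V} {s : ℕ}
    (h : SameOrbit Ω B x y) (hx : HasDeltaDecomp Ω B x s) : HasDeltaDecomp Ω B y s := by
  obtain ⟨g, hg, rfl⟩ := h
  obtain ⟨hs, f, hf, hort, rfl⟩ := hx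
  exact ⟨hs, fun i => g (f i), fun i => Gamma.map_mem_delta hg (hf i),
    fun i j hij => by rw [Gamma.isometry hΩ hg, hort i j hij], map_sum g f _⟩

lemma exists_mem_delta_apply_eq_one (hB : IsBasisSet B) {x : V} (hx : x ∉ V0set Ω) :
    ∃ z ∈ Delta Ω B, Ω x z = 1 := by
  by_contra! hne
  refine hx fun v => ?_
  have : Ω x = 0 := LinearMap.ext_on hB.2 fun b hb =>
    (zmod_two_cases _).resolve_right (hne b (mem_delta_of_mem hb))
  rw [this, LinearMap.zero_apply]

end

/-- If `B` is a basis of `V` with `Gr(B)` connected, then every nonzero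
`x ∈ V` admits a `Δ`-decomposition (so `d(x)` is well defined), and two vectors
`x, y ∈ V ∖ V₀` lie in the same `Γ_B`-orbit iff `d(x) = d(y)`. -/
theorem stmt_0 {V : Type*} [AddCommGroup V] [Module (ZMod 2) V]
    [FiniteDimensional (ZMod 2) V]
    (Ω : BForm V) (hΩ : ∀ x : V, Ω x x = 0)
    (B : Set V) (hB : IsBasisSet B) (hconn : (Gr Ω B).Connected) :
    (∀ x : V, x ≠ 0 → ∃ s : ℕ, HasDeltaDecomp Ω B x s) ∧
    (∀ x y : V, x ∉ V0set Ω → y ∉ V0set Ω →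
      (SameOrbit Ω B x y ↔ dval Ω B x = dval Ω B y)) := by
  have hD := isVanishing_delta hΩ hconn
  have hrep : ∀ x : V, ∃ m, IsMinRep (Delta Ω B) m ∧ m.sum = x :=
    fun x => exists_isMinRep (exists_multiset_sum_eq hB x)
  refine ⟨fun x hx => ?_, fun x y hx hy => ⟨fun h => ?_, fun h => ?_⟩⟩
  · obtain ⟨m, hm, rfl⟩ := hrep x
    exact ⟨_, hm.hasDeltaDecomp hΩ hD hx⟩
  · unfold dval
    congr 1
    ext s
    exact ⟨HasDeltaDecomp.of_sameOrbit hΩ h, HasDeltaDecomp.of_sameOrbit hΩ h.symm⟩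
  · obtain ⟨m, hm, rfl⟩ := hrep x
    obtain ⟨m', hm', rfl⟩ := hrep y
    have hne : ∀ u ∉ V0set Ω, u ≠ 0 := by
      rintro u hu rfl
      exact hu fun v => by simp
    rw [hm.dval_eq hΩ hD (hne _ hx), hm'.dval_eq hΩ hD (hne _ hy)] at h
    exact .of_transRel hΩ (IsMinRep.transRel hΩ _ hD hm hm' h rfl
      (exists_mem_delta_apply_eq_one hB hx) (exists_mem_delta_apply_eq_one hB hy))
end

section
/- Let B be a basis of V such that Gr(B) is connected, and suppose B is equivalent to a basis B' such that Gr(B') is a tree containing E₆ as an induced subgraph. Then for every x ∈ V∖V₀ one has d(x)=1 if Q_B(x)=1 and d(x)=2 if Q_B(x)=0 (that is, d(x)=2−Q_B(x), reading Q_B(x)∈{0,1} as an integer). -/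
open scoped BigOperators

variable {V : Type*} [AddCommGroup V] [Module (ZMod 2) V]

/-! ### Arithmetic of the `E₆` root system modulo two

A vector of `𝔽₂⁶` is encoded by the binary digits of a natural number below `64`. -/

namespace E6Mod2

/-- The image of a Boolean in `ZMod 2`. -/
def ofB (b : Bool) : ZMod 2 := if b then 1 else 0

/-- The standard pairing of two bit vectors of length six. -/
def par (f n : ℕ) : Bool :=
  (f.testBit 0 && n.testBit 0) ^^ (f.testBit 1 && n.testBit 1) ^^ (f.testBit 2 && n.testBit 2) ^^
    (f.testBit 3 && n.testBit 3) ^^ (f.testBit 4 && n.testBit 4) ^^ (f.testBit 5 && n.testBit 5)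

/-- The quadratic form of `E₆` modulo two. -/
def quad (n : ℕ) : Bool :=
  par 63 n ^^ (n.testBit 0 && n.testBit 1) ^^ (n.testBit 1 && n.testBit 2) ^^
    (n.testBit 2 && n.testBit 3) ^^ (n.testBit 3 && n.testBit 4) ^^ (n.testBit 2 && n.testBit 5)

/-- The rows of the adjacency matrix of `E₆`. -/
def row (i : ℕ) : ℕ := [2, 5, 42, 20, 8, 4].getD i 0

/-- Enlarge a list of bit vectors by all sums with a non-orthogonal coordinate vector. -/
def grow (L : List ℕ) : List ℕ :=
  (List.range 64).filter fun c =>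
    L.contains c || (List.range 6).any fun i => par (row i) c && L.contains (c ^^^ 2 ^ i)

theorem mem_grow_of_quad :
    ∀ n < 64, quad n = true → n ∈ grow^[10] [1, 2, 4, 8, 16, 32] := by
  decide +kernel

theorem exists_separating_root :
    ∀ f < 64, ∀ g < 64, f ≠ 0 → f ≠ g → ∃ n < 64, quad n = true ∧ par f n = true ∧
      par g n = false ∧ ∃ i < 6, (g.testBit i ^^ par (row i) n) = true := by
  set_option synthInstance.maxHeartbeats 400000 in
  set_option synthInstance.maxSize 1000 in
  decide +kernel

theorem exists_shift :
    ∀ f < 64, ∀ c : Bool, ∃ n < 64, (c ^^ quad n ^^ par f n) = true ∧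
      ∃ i < 6, (f.testBit i ^^ par (row i) n) = true := by
  decide +kernel

theorem exists_orthogonal_root :
    ∀ f < 64, ∃ n < 64, quad n = true ∧ par f n = false ∧
      ∃ i < 6, (f.testBit i ^^ par (row i) n) = true := by
  decide +kernel

theorem ofB_xor (a b : Bool) : ofB (a ^^ b) = ofB a + ofB b := by
  cases a <;> cases b <;> decide

theorem ofB_and (a b : Bool) : ofB (a && b) = ofB a * ofB b := by
  cases a <;> cases b <;> decide

theorem ofB_eq_one {b : Bool} : ofB b = 1 ↔ b = true := by
  cases b <;> decide

theorem eq_zero_or_one : ∀ z : ZMod 2, z = 0 ∨ z = 1 := by decide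

theorem exists_ofB (z : ZMod 2) : ∃ b, z = ofB b := by
  rcases eq_zero_or_one z with rfl | rfl
  exacts [⟨false, rfl⟩, ⟨true, rfl⟩]

/-- The combination of the vectors `e i` whose coefficients are the bits of `n`. -/
def vec (e : ℕ → V) (n : ℕ) : V := ∑ i ∈ Finset.range 6, ofB (n.testBit i) • e i

theorem vec_mem {e : ℕ → V} {W : Submodule (ZMod 2) V} (he : ∀ i < 6, e i ∈ W) (n : ℕ) :
    vec e n ∈ W :=
  W.sum_mem fun i hi => W.smul_mem _ (he i (Finset.mem_range.1 hi))

theorem vec_xor (e : ℕ → V) (m n : ℕ) : vec e (m ^^^ n) = vec e m + vec e n := by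
  simp only [vec, Nat.testBit_xor, ofB_xor, add_smul, Finset.sum_add_distrib]

theorem vec_two_pow (e : ℕ → V) {i : ℕ} (hi : i < 6) : vec e (2 ^ i) = e i := by
  rw [vec, Finset.sum_eq_single i]
  · simp [ofB]
  · intro j _ hj
    simp [ofB, Ne.symm hj]
  · intro h
    exact absurd (Finset.mem_range.2 hi) h

/-- The values of `Ω x` on six vectors, encoded as a bit vector. -/
theorem exists_code (Ω : BForm V) (e : ℕ → V) (x : V) :
    ∃ f < 64, ∀ i < 6, Ω x (e i) = ofB (f.testBit i) := by
  choose b hb using fun i => exists_ofB (Ω x (e i))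
  refine ⟨Nat.ofBits fun i : Fin 6 => b i, Nat.ofBits_lt_two_pow _, fun i hi => ?_⟩
  rw [Nat.testBit_ofBits_lt _ _ hi, hb i]

theorem form_vec {Ω : BForm V} {e : ℕ → V} {x : V} {f : ℕ}
    (hf : ∀ i < 6, Ω x (e i) = ofB (f.testBit i)) (n : ℕ) :
    Ω x (vec e n) = ofB (par f n) := by
  simp only [vec, par, Finset.sum_range_succ, Finset.sum_range_zero, map_add, map_smul, ofB_xor,
    ofB_and, smul_eq_mul, zero_add]
  simp (disch := norm_num) only [hf]
  ring

theorem exists_of_form_vec {Ω : BForm V} {e : ℕ → V} {x : V} {n : ℕ}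
    (h : Ω x (vec e n) = 1) : ∃ i < 6, Ω x (e i) = 1 := by
  by_contra! hne
  have h0 : ∀ i < 6, Ω x (e i) = 0 := fun i hi => (eq_zero_or_one _).resolve_right (hne i hi)
  rw [vec, map_sum, Finset.sum_eq_zero] at h
  · exact zero_ne_one h
  · intro i hi
    rw [map_smul, h0 i (Finset.mem_range.1 hi), smul_zero]

end E6Mod2

open E6Mod2

theorem form_comm_of_alternating {Ω : BForm V} (hΩ : ∀ x : V, Ω x x = 0) (x y : V) :
    Ω x y = Ω y x := by
  have h := hΩ (x + y)
  simp only [map_add, LinearMap.add_apply, hΩ, zero_add, add_zero] at h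
  rw [← sub_eq_zero, CharTwo.sub_eq_add, add_comm]
  exact h

/-- `Q` is a quadratic form with polarization the alternating form `Ω`, the set `D` is closed under
sums of non-orthogonal pairs and contains vectors `e 0, …, e 5` spanning a copy of `E₆`. -/
structure E6Frame (Ω : BForm V) (Q : V → ZMod 2) (D : Set V) (e : ℕ → V) : Prop where
  alt : ∀ x, Ω x x = 0
  polar : ∀ u v, Q (u + v) = Q u + Q v + Ω u v
  value : ∀ x ∈ D, Q x = 1
  add_mem : ∀ x ∈ D, ∀ y ∈ D, Ω x y = 1 → x + y ∈ D
  root_mem : ∀ i < 6, e i ∈ D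
  gram : ∀ i < 6, ∀ j < 6, Ω (e i) (e j) = ofB ((row i).testBit j)

namespace E6Frame

variable {Ω : BForm V} {Q : V → ZMod 2} {D : Set V} {e : ℕ → V}

theorem map_zero (F : E6Frame Ω Q D e) : Q 0 = 0 := by
  have h := F.polar 0 0
  simpa using h

theorem map_ofB_smul (F : E6Frame Ω Q D e) (b : Bool) (v : V) : Q (ofB b • v) = ofB b * Q v := by
  cases b <;> simp [ofB, F.map_zero]

theorem quad_vec (F : E6Frame Ω Q D e) (n : ℕ) : Q (vec e n) = ofB (quad n) := by
  have hv : ∀ i < 6, Q (e i) = 1 := fun i hi => F.value _ (F.root_mem i hi)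
  have hg : ∀ i j (_ : i < 6) (_ : j < 6), Ω (e i) (e j) = ofB ((row i).testBit j) :=
    fun i j hi hj => F.gram i hi j hj
  simp only [vec, Finset.sum_range_succ, Finset.sum_range_zero, zero_add, F.polar, F.map_ofB_smul,
    map_add, map_smul, LinearMap.add_apply, LinearMap.smul_apply, smul_eq_mul]
  simp only [hv 0 (by norm_num), hv 1 (by norm_num), hv 2 (by norm_num), hv 3 (by norm_num),
    hv 4 (by norm_num), hv 5 (by norm_num)]
  simp (disch := norm_num) only [hg]
  simp only [quad, par, ofB_xor, ofB_and]
  generalize ofB (n.testBit 0) = a₀, ofB (n.testBit 1) = a₁, ofB (n.testBit 2) = a₂,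
    ofB (n.testBit 3) = a₃, ofB (n.testBit 4) = a₄, ofB (n.testBit 5) = a₅
  simp [row, Nat.testBit, ofB]
  ring

theorem vec_root_mem (F : E6Frame Ω Q D e) {n : ℕ} (hn : n < 64) (hq : quad n = true) :
    vec e n ∈ D := by
  have key : ∀ k, ∀ c ∈ grow^[k] [1, 2, 4, 8, 16, 32], vec e c ∈ D := by
    intro k
    induction k with
    | zero =>
      have hr : ∀ i < 6, vec e (2 ^ i) ∈ D := fun i hi => by
        rw [vec_two_pow e hi]
        exact F.root_mem i hi
      intro c hc
      simp only [Function.iterate_zero, id_eq, List.mem_cons, List.not_mem_nil, or_false] at hc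
      rcases hc with rfl | rfl | rfl | rfl | rfl | rfl
      exacts [hr 0 (by norm_num), hr 1 (by norm_num), hr 2 (by norm_num), hr 3 (by norm_num),
        hr 4 (by norm_num), hr 5 (by norm_num)]
    | succ k ih =>
      intro c hc
      rw [Function.iterate_succ_apply', grow] at hc
      simp only [List.mem_filter, List.mem_range, Bool.or_eq_true, List.contains_iff_mem,
        List.any_eq_true, Bool.and_eq_true] at hc
      rcases hc.2 with h | ⟨i, hi, hp, h⟩
      · exact ih c h
      · have h1 := ih _ h
        have h2 := F.root_mem i hi
        have h3 : Ω (e i) (vec e c) = 1 := by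
          rw [form_vec (F.gram i hi), hp]
          rfl
        have h4 := F.add_mem _ h2 _ h1 (by
          rw [vec_xor, vec_two_pow e hi, map_add, F.alt, h3, add_zero])
        rwa [vec_xor, vec_two_pow e hi, add_left_comm, ZModModule.add_self, add_zero] at h4
  exact key 10 n (mem_grow_of_quad n hn hq)

theorem form_add_vec (F : E6Frame Ω Q D e) {x : V} {f : ℕ}
    (hf : ∀ i < 6, Ω x (e i) = ofB (f.testBit i)) (n : ℕ) {i : ℕ} (hi : i < 6) :
    Ω (x + vec e n) (e i) = ofB (f.testBit i ^^ par (row i) n) := by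
  rw [map_add, LinearMap.add_apply, hf i hi, form_comm_of_alternating F.alt,
    form_vec (F.gram i hi), ofB_xor]

/-- Two vectors whose restrictions to the `E₆` space are different, the first one nonzero,
are separated by a root. -/
theorem exists_separating (F : E6Frame Ω Q D e) {W : Submodule (ZMod 2) V}
    (he : ∀ i < 6, e i ∈ W) {s w : V} (hs : ∃ i < 6, Ω s (e i) = 1)
    (hws : ∃ i < 6, Ω (w + s) (e i) = 1) :
    ∃ n, vec e n ∈ W ∧ vec e n ∈ D ∧ Ω s (vec e n) = 1 ∧ Ω w (vec e n) = 0 ∧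
      ∃ i < 6, Ω (w + vec e n) (e i) = 1 := by
  obtain ⟨f, hf, hsf⟩ := exists_code Ω e s
  obtain ⟨g, hg, hwg⟩ := exists_code Ω e w
  have hf0 : f ≠ 0 := by
    rintro rfl
    obtain ⟨i, hi, h⟩ := hs
    rw [hsf i hi] at h
    simp [ofB] at h
  have hfg : f ≠ g := by
    rintro rfl
    obtain ⟨i, hi, h⟩ := hws
    rw [map_add, LinearMap.add_apply, hsf i hi, hwg i hi, CharTwo.add_self_eq_zero] at h
    exact zero_ne_one h
  obtain ⟨n, hn, hq, hfn, hgn, i, hi, h⟩ := exists_separating_root f hf g hg hf0 hfg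
  refine ⟨n, vec_mem he n, F.vec_root_mem hn hq, ?_, ?_, i, hi, ?_⟩
  · rw [form_vec hsf, hfn]; rfl
  · rw [form_vec hwg, hgn]; rfl
  · rw [F.form_add_vec hwg n hi, h]; rfl

/-- Every vector can be moved by the `E₆` space to one with `Q = 1` which is not orthogonal to it. -/
theorem exists_shift (F : E6Frame Ω Q D e) {W : Submodule (ZMod 2) V}
    (he : ∀ i < 6, e i ∈ W) (t : V) :
    ∃ n, vec e n ∈ W ∧ Q (t + vec e n) = 1 ∧ ∃ i < 6, Ω (t + vec e n) (e i) = 1 := by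
  obtain ⟨f, hf, htf⟩ := exists_code Ω e t
  obtain ⟨c, hc⟩ := exists_ofB (Q t)
  obtain ⟨n, hn, hq, i, hi, h⟩ := E6Mod2.exists_shift f hf c
  refine ⟨n, vec_mem he n, ?_, i, hi, ?_⟩
  · rw [F.polar, hc, F.quad_vec, form_vec htf, ← ofB_xor, ← ofB_xor, ofB_eq_one]
    exact hq
  · rw [F.form_add_vec htf n hi, h]; rfl

/-- Every vector is orthogonal to a root from which it differs on the `E₆` space. -/
theorem exists_orthogonal (F : E6Frame Ω Q D e) (x : V) :
    ∃ y ∈ D, Ω x y = 0 ∧ ∃ i < 6, Ω (x + y) (e i) = 1 := by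
  obtain ⟨f, hf, hxf⟩ := exists_code Ω e x
  obtain ⟨n, hn, hq, hfn, i, hi, h⟩ := exists_orthogonal_root f hf
  refine ⟨vec e n, F.vec_root_mem hn hq, ?_, i, hi, ?_⟩
  · rw [form_vec hxf, hfn]; rfl
  · rw [F.form_add_vec hxf n hi, h]; rfl

/-- All vectors of `W` outside the kernel of `Ω` on `W` with `Q = 1` lie in `D`. -/
def Full (Ω : BForm V) (Q : V → ZMod 2) (D : Set V) (W : Submodule (ZMod 2) V) : Prop :=
  ∀ x ∈ W, Q x = 1 → (∃ v ∈ W, Ω x v = 1) → x ∈ D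

/-- Membership in `D` can be tested after adding a non-orthogonal element of `D`. -/
theorem mem_of_add_mem (F : E6Frame Ω Q D e) {x r : V} (hr : r ∈ D) (hxr : Ω x r = 1)
    (h : x + r ∈ D) : x ∈ D := by
  have h1 := F.add_mem _ h _ hr (by rw [map_add, LinearMap.add_apply, hxr, F.alt, add_zero])
  rwa [add_assoc, ZModModule.add_self, add_zero] at h1

theorem quad_add_of_form_eq_one (F : E6Frame Ω Q D e) {x r : V} (hx : Q x = 1) (hr : Q r = 1)
    (hxr : Ω x r = 1) : Q (x + r) = 1 := by
  rw [F.polar, hx, hr, hxr]; decide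

theorem add_mem_of_isotropic (F : E6Frame Ω Q D e) {W : Submodule (ZMod 2) V}
    (he : ∀ i < 6, e i ∈ W) (hW : Full Ω Q D W) {s w : V} (hsD : s ∈ D)
    (hs : ∃ i < 6, Ω s (e i) = 1) (hw : w ∈ W) (hQ : Q (w + s) = 1) (hO : Ω w s = 0)
    (hws : ∃ i < 6, Ω (w + s) (e i) = 1) : w + s ∈ D := by
  obtain ⟨n, hrW, hrD, hsr, hwr, i, hi, hne⟩ := F.exists_separating he hs hws
  set r := vec e n
  have hQw : Q w = 0 := by
    rw [F.polar, F.value s hsD, hO] at hQ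
    simpa using hQ
  have h1 : w + r ∈ D := hW _ (W.add_mem hw hrW)
    (by rw [F.polar, hQw, F.value r hrD, hwr]; decide) ⟨e i, he i hi, hne⟩
  have h2 : w + r + s ∈ D := F.add_mem _ h1 _ hsD (by
    rw [map_add, LinearMap.add_apply, hO, form_comm_of_alternating F.alt r, hsr, zero_add])
  refine F.mem_of_add_mem hrD ?_ (by rwa [add_right_comm])
  rw [map_add, LinearMap.add_apply, hwr, hsr, zero_add]

theorem add_mem_of_nonorthogonal (F : E6Frame Ω Q D e) {W : Submodule (ZMod 2) V}
    (he : ∀ i < 6, e i ∈ W) (hW : Full Ω Q D W) {s w : V} (hsD : s ∈ D)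
    (hs : ∃ i < 6, Ω s (e i) = 1) (hw : w ∈ W) (hQ : Q (w + s) = 1)
    (hws : ∃ i < 6, Ω (w + s) (e i) = 1) : w + s ∈ D := by
  rcases eq_zero_or_one (Ω w s) with hO | hO
  · exact F.add_mem_of_isotropic he hW hsD hs hw hQ hO hws
  have hQw : Q w = 1 := by
    rw [F.polar, F.value s hsD, hO, add_assoc, CharTwo.add_self_eq_zero, add_zero] at hQ
    exact hQ
  by_cases hrad : ∃ v ∈ W, Ω w v = 1
  · exact F.add_mem _ (hW w hw hQw hrad) _ hsD hO
  have hw0 : ∀ v ∈ W, Ω w v = 0 := fun v hv =>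
    (eq_zero_or_one _).resolve_right fun h => hrad ⟨v, hv, h⟩
  obtain ⟨n, hrW, hrD, hsr, -, -⟩ := F.exists_separating (w := 0) he hs (by rwa [zero_add])
  set r := vec e n with hr
  have hxr : Ω (w + s) r = 1 := by
    rw [map_add, LinearMap.add_apply, hw0 r hrW, hsr, zero_add]
  refine F.mem_of_add_mem hrD hxr ?_
  rw [add_right_comm]
  have hrs : Ω r s = 1 := by rw [form_comm_of_alternating F.alt, hsr]
  refine F.add_mem_of_isotropic he hW hsD hs (W.add_mem hw hrW) ?_ ?_ ?_
  · rw [add_right_comm]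
    exact F.quad_add_of_form_eq_one hQ (F.value r hrD) hxr
  · rw [map_add, LinearMap.add_apply, hO, hrs, CharTwo.add_self_eq_zero]
  · refine exists_of_form_vec (n := n) ?_
    rw [← hr, add_right_comm, map_add, LinearMap.add_apply, hxr, F.alt, add_zero]

theorem full_extension (F : E6Frame Ω Q D e) {W : Submodule (ZMod 2) V}
    (he : ∀ i < 6, e i ∈ W) (hW : Full Ω Q D W) {s : V} (hsD : s ∈ D)
    (hs : ∃ i < 6, Ω s (e i) = 1) {x : V} (hx : x ∈ W ∨ x + s ∈ W) (hQ : Q x = 1)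
    (hv : ∃ v, (v ∈ W ∨ v + s ∈ W) ∧ Ω x v = 1) : x ∈ D := by
  have outside : ∀ w ∈ W, Q (w + s) = 1 → (∃ v, (v ∈ W ∨ v + s ∈ W) ∧ Ω (w + s) v = 1) →
      w + s ∈ D := by
    intro w hw hQ hv
    by_cases hws : ∃ i < 6, Ω (w + s) (e i) = 1
    · exact F.add_mem_of_nonorthogonal he hW hsD hs hw hQ hws
    by_cases hvW : ∃ v ∈ W, Ω (w + s) v = 1
    · obtain ⟨v, hvW, hv1⟩ := hvW
      obtain ⟨n, hn, hQn, i, hi, hni⟩ := F.exists_shift he v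
      have hxn : Ω (w + s) (vec e n) = 0 :=
        (eq_zero_or_one _).resolve_right fun h => hws (exists_of_form_vec h)
      have hrW : v + vec e n ∈ W := W.add_mem hvW hn
      have hrD : v + vec e n ∈ D := hW _ hrW hQn ⟨e i, he i hi, hni⟩
      have hxr : Ω (w + s) (v + vec e n) = 1 := by rw [map_add, hv1, hxn, add_zero]
      have hxi : Ω (w + s) (e i) = 0 :=
        (eq_zero_or_one _).resolve_right fun h => hws ⟨i, hi, h⟩
      refine F.mem_of_add_mem hrD hxr ?_
      rw [add_right_comm]
      refine F.add_mem_of_nonorthogonal he hW hsD hs (W.add_mem hw hrW) ?_ ⟨i, hi, ?_⟩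
      · rw [add_right_comm]
        exact F.quad_add_of_form_eq_one hQ (F.value _ hrD) hxr
      · rw [add_right_comm, map_add, LinearMap.add_apply, hxi, hni, zero_add]
    · have h0 : ∀ v ∈ W, Ω (w + s) v = 0 := fun v hv =>
        (eq_zero_or_one _).resolve_right fun h => hvW ⟨v, hv, h⟩
      obtain ⟨v, hv, hv1⟩ := hv
      have hvs : v + s ∈ W := hv.resolve_left fun h => by
        rw [h0 v h] at hv1
        exact zero_ne_one hv1
      have hOs : Ω (w + s) s = 1 := by
        have := h0 _ hvs
        rw [map_add, hv1] at this
        rwa [← CharTwo.add_eq_zero, add_comm]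
      rw [map_add, LinearMap.add_apply, F.alt, add_zero] at hOs
      have hQw : Q w = 1 := by
        rwa [F.polar, F.value s hsD, hOs, add_assoc, CharTwo.add_self_eq_zero, add_zero] at hQ
      obtain ⟨i, hi, hsi⟩ := hs
      have hwi : Ω w (e i) = 1 := by
        have := h0 _ (he i hi)
        rwa [map_add, LinearMap.add_apply, hsi, CharTwo.add_eq_zero] at this
      exact F.add_mem _ (hW w hw hQw ⟨e i, he i hi, hwi⟩) _ hsD hOs
  rcases hx with hxW | hxs
  · by_cases hrad : ∃ v ∈ W, Ω x v = 1
    · exact hW x hxW hQ hrad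
    have h0 : ∀ v ∈ W, Ω x v = 0 := fun v hv =>
      (eq_zero_or_one _).resolve_right fun h => hrad ⟨v, hv, h⟩
    obtain ⟨v, hv, hv1⟩ := hv
    have hvs : v + s ∈ W := hv.resolve_left fun h => by
      rw [h0 v h] at hv1
      exact zero_ne_one hv1
    have hOs : Ω x s = 1 := by
      have := h0 _ hvs
      rw [map_add, hv1] at this
      rwa [← CharTwo.add_eq_zero, add_comm]
    refine F.mem_of_add_mem hsD hOs (outside x hxW ?_ ⟨s, Or.inr ?_, ?_⟩)
    · exact F.quad_add_of_form_eq_one hQ (F.value s hsD) hOs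
    · rw [ZModModule.add_self]
      exact W.zero_mem
    · rw [map_add, LinearMap.add_apply, hOs, F.alt, add_zero]
  · have hx : x + s + s = x := by rw [add_assoc, ZModModule.add_self, add_zero]
    have := outside (x + s) hxs
    rw [hx] at this
    exact this hQ hv

theorem mem_or_add_mem_of_mem_sup {W : Submodule (ZMod 2) V} {s x : V}
    (hx : x ∈ W ⊔ Submodule.span (ZMod 2) {s}) : x ∈ W ∨ x + s ∈ W := by
  obtain ⟨w, hw, y, hy, rfl⟩ := Submodule.mem_sup.1 hx
  obtain ⟨c, rfl⟩ := Submodule.mem_span_singleton.1 hy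
  rcases eq_zero_or_one c with rfl | rfl
  · left
    simpa using hw
  · right
    rwa [one_smul, add_assoc, ZModModule.add_self, add_zero]

/-- Fullness passes to the span with a further element of `D` not orthogonal to the subspace. -/
theorem full_sup_span (F : E6Frame Ω Q D e) {W : Submodule (ZMod 2) V}
    (he : ∀ i < 6, e i ∈ W) (hW : Full Ω Q D W) {s t : V} (hsD : s ∈ D) (ht : t ∈ W)
    (hst : Ω s t = 1) : Full Ω Q D (W ⊔ Submodule.span (ZMod 2) {s}) := by
  obtain ⟨s', hsD', hs', hss'⟩ : ∃ s' ∈ D, (∃ i < 6, Ω s' (e i) = 1) ∧ s + s' ∈ W := by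
    by_cases hs : ∃ i < 6, Ω s (e i) = 1
    · refine ⟨s, hsD, hs, ?_⟩
      rw [ZModModule.add_self]
      exact W.zero_mem
    obtain ⟨n, hn, hQn, i, hi, hni⟩ := F.exists_shift he t
    have hsn : Ω s (vec e n) = 0 :=
      (eq_zero_or_one _).resolve_right fun h => hs (exists_of_form_vec h)
    have hsi : Ω s (e i) = 0 := (eq_zero_or_one _).resolve_right fun h => hs ⟨i, hi, h⟩
    have htW := W.add_mem ht hn
    refine ⟨s + (t + vec e n), F.add_mem _ hsD _ (hW _ htW hQn ⟨e i, he i hi, hni⟩) ?_,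
      ⟨i, hi, ?_⟩, ?_⟩
    · rw [map_add, hst, hsn, add_zero]
    · rw [map_add, LinearMap.add_apply, hsi, hni, zero_add]
    · rwa [← add_assoc, ZModModule.add_self, zero_add]
  have change : ∀ x ∈ W ⊔ Submodule.span (ZMod 2) {s}, x ∈ W ∨ x + s' ∈ W := fun x hx =>
    (mem_or_add_mem_of_mem_sup hx).imp_right fun h => by
      have := W.add_mem h hss'
      rwa [add_assoc, ← add_assoc s, ZModModule.add_self, zero_add] at this
  rintro x hx hQ ⟨v, hv, hxv⟩
  exact F.full_extension he hW hsD' hs' (change x hx) hQ ⟨v, change v hv, hxv⟩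

theorem full_span (F : E6Frame Ω Q D e) :
    Full Ω Q D (Submodule.span (ZMod 2) (e '' Set.Iio 6)) := by
  rintro x hx hQ -
  have hvec : ∃ n < 64, x = vec e n := by
    clear hQ
    induction hx using Submodule.span_induction with
    | mem x hx =>
      obtain ⟨i, hi, rfl⟩ := hx
      exact ⟨2 ^ i, Nat.pow_lt_pow_right one_lt_two hi, (vec_two_pow e hi).symm⟩
    | zero => exact ⟨0, by norm_num, by simp [vec, ofB]⟩
    | add x y _ _ hx hy =>
      obtain ⟨m, hm, rfl⟩ := hx
      obtain ⟨n, hn, rfl⟩ := hy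
      exact ⟨m ^^^ n, Nat.xor_lt_two_pow (n := 6) hm hn, (vec_xor e m n).symm⟩
    | smul c x _ hx =>
      rcases eq_zero_or_one c with rfl | rfl
      · exact ⟨0, by norm_num, by simp [vec, ofB]⟩
      · rwa [one_smul]
  obtain ⟨n, hn, rfl⟩ := hvec
  rw [F.quad_vec, ofB_eq_one] at hQ
  exact F.vec_root_mem hn hQ

/-- If `D` contains a connected spanning set `S` which contains the `E₆` vectors, then `D` consists
of all vectors with `Q = 1` outside the kernel. -/
theorem full_top [FiniteDimensional (ZMod 2) V] (F : E6Frame Ω Q D e) {S : Set V} (hSD : S ⊆ D)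
    (hspan : Submodule.span (ZMod 2) S = ⊤) (hS : (Gr Ω S).Connected) (heS : ∀ i < 6, e i ∈ S) :
    Full Ω Q D ⊤ := by
  obtain ⟨W, ⟨he, hW⟩, hmax⟩ := exists_maximal_of_wellFoundedGT
    (fun W : Submodule (ZMod 2) V => (∀ i < 6, e i ∈ W) ∧ Full Ω Q D W)
    ⟨_, fun i hi => Submodule.subset_span (Set.mem_image_of_mem e hi), F.full_span⟩
  have hSW : S ⊆ W := by
    have step : ∀ u v : S, (Gr Ω S).Adj u v → u.1 ∈ W → v.1 ∈ W := by
      intro u v huv hu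
      have hvu : Ω v.1 u.1 = 1 := by
        rcases ((SimpleGraph.fromRel_adj _ _ _).1 huv).2 with h | h
        · rwa [form_comm_of_alternating F.alt]
        · exact h
      have hfull := F.full_sup_span he hW (hSD v.2) hu hvu
      exact hmax ⟨fun i hi => Submodule.mem_sup_left (he i hi), hfull⟩ le_sup_left
        (Submodule.mem_sup_right (Submodule.mem_span_singleton_self _))
    have walk : ∀ u v : S, (Gr Ω S).Walk u v → u.1 ∈ W → v.1 ∈ W := by
      intro u v p
      induction p with
      | nil => exact id
      | cons h _ ih => exact fun hu => ih (step _ _ h hu)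
    intro x hx
    obtain ⟨p⟩ := hS.preconnected ⟨e 0, heS 0 (by norm_num)⟩ ⟨x, hx⟩
    exact walk _ _ p (he 0 (by norm_num))
  have htop : W = ⊤ := top_le_iff.1 (hspan ▸ Submodule.span_le.2 hSW)
  rwa [← htop]

end E6Frame

section Orbit

variable {Ω : BForm V} {B : Set V}

theorem exists_isTransvection (hΩ : ∀ x : V, Ω x x = 0) {b : V} (hb : b ∈ B) :
    ∃ g ∈ Gamma Ω B, ∀ x, g x = x + Ω x b • b := by
  let f : V →ₗ[ZMod 2] V := LinearMap.id + (Ω.flip b).smulRight b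
  have hf : ∀ x, f x = x + Ω x b • b := fun x => rfl
  have hinv : Function.Involutive f := fun x => by
    rw [hf, hf, map_add, LinearMap.add_apply, map_smul, LinearMap.smul_apply, hΩ, smul_zero,
      add_zero, add_assoc, ZModModule.add_self, add_zero]
  exact ⟨LinearEquiv.ofInvolutive f hinv, Subgroup.subset_closure ⟨b, hb, hf⟩, hf⟩

theorem form_gamma (hΩ : ∀ x : V, Ω x x = 0) {g : V ≃ₗ[ZMod 2] V} (hg : g ∈ Gamma Ω B) :
    ∀ x y, Ω (g x) (g y) = Ω x y := by
  induction hg using Subgroup.closure_induction with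
  | mem g hg =>
    obtain ⟨b, -, h⟩ := hg
    intro x y
    simp only [h, map_add, LinearMap.add_apply, map_smul, LinearMap.smul_apply, hΩ, smul_eq_mul,
      mul_zero, add_zero]
    rw [form_comm_of_alternating hΩ b y, mul_comm (Ω y b), add_assoc, CharTwo.add_self_eq_zero,
      add_zero]
  | one => exact fun _ _ => rfl
  | mul g h _ _ ihg ihh => exact fun x y => (ihg _ _).trans (ihh _ _)
  | inv g _ ih =>
    intro x y
    have := ih (g⁻¹ x) (g⁻¹ y)
    rwa [← LinearEquiv.mul_apply, ← LinearEquiv.mul_apply, mul_inv_cancel, eq_comm] at this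

theorem quad_gamma {Q : V → ZMod 2} (hQ : IsQuadForm Ω B Q) {g : V ≃ₗ[ZMod 2] V}
    (hg : g ∈ Gamma Ω B) : ∀ x, Q (g x) = Q x := by
  induction hg using Subgroup.closure_induction with
  | mem g hg =>
    obtain ⟨b, hb, h⟩ := hg
    intro x
    rw [h]
    rcases eq_zero_or_one (Ω x b) with h0 | h1
    · rw [h0, zero_smul, add_zero]
    · rw [h1, one_smul, hQ.2, hQ.1 b hb, h1, add_assoc, CharTwo.add_self_eq_zero, add_zero]
  | one => exact fun _ => rfl
  | mul g h _ _ ihg ihh => exact fun x => (ihg _).trans (ihh _)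
  | inv g _ ih =>
    intro x
    have := ih (g⁻¹ x)
    rwa [← LinearEquiv.mul_apply, mul_inv_cancel, eq_comm] at this

theorem quad_eq_one_of_mem_delta {Q : V → ZMod 2} (hQ : IsQuadForm Ω B Q) {x : V}
    (hx : x ∈ Delta Ω B) : Q x = 1 := by
  obtain ⟨b, hb, g, hg, rfl⟩ := hx
  rw [quad_gamma hQ hg, hQ.1 b hb]

theorem subset_delta : B ⊆ Delta Ω B := fun b hb => ⟨b, hb, 1, Subgroup.one_mem _, rfl⟩

theorem add_mem_delta (hΩ : ∀ x : V, Ω x x = 0) {x y : V} (hx : x ∈ Delta Ω B)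
    (hy : y ∈ Delta Ω B) (hxy : Ω x y = 1) : x + y ∈ Delta Ω B := by
  obtain ⟨b, hb, g, hg, rfl⟩ := hx
  obtain ⟨c, hc, h, hh, rfl⟩ := hy
  obtain ⟨t, ht, htx⟩ := exists_isTransvection hΩ hc
  refine ⟨b, hb, h * t * h⁻¹ * g,
    mul_mem (mul_mem (mul_mem hh ht) (inv_mem hh)) hg, ?_⟩
  have hhg : h (h⁻¹ (g b)) = g b := by
    rw [← LinearEquiv.mul_apply, mul_inv_cancel]
    rfl
  have hform : Ω (h⁻¹ (g b)) c = 1 := by rw [← form_gamma hΩ hh, hhg, hxy]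
  rw [LinearEquiv.mul_apply, LinearEquiv.mul_apply, LinearEquiv.mul_apply, htx, hform, one_smul,
    map_add, hhg]

/-- A set equivalent to `B` spans at least as much and is contained in the orbit of `B`. -/
theorem span_le_and_subset_delta_of_equivSets (hΩ : ∀ x : V, Ω x x = 0) {B' : Set V}
    (h : EquivSets Ω B B') :
    Submodule.span (ZMod 2) B ≤ Submodule.span (ZMod 2) B' ∧ B' ⊆ Delta Ω B := by
  induction h with
  | refl => exact ⟨le_rfl, subset_delta⟩
  | @tail C C' _ hmove ih =>
    obtain ⟨a, c, ha, hc, hac, hO, rfl⟩ := hmove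
    refine ⟨ih.1.trans (Submodule.span_le.2 fun x hx => ?_), ?_⟩
    · have ha' : a ∈ Submodule.span (ZMod 2) (insert (c + a) (C \ {c})) :=
        Submodule.subset_span (Or.inr ⟨ha, hac⟩)
      by_cases hxc : x = c
      · have h1 : c + a ∈ Submodule.span (ZMod 2) (insert (c + a) (C \ {c})) :=
          Submodule.subset_span (Or.inl rfl)
        have h2 := add_mem h1 ha'
        rw [add_assoc, ZModModule.add_self, add_zero] at h2
        rwa [hxc]
      · exact Submodule.subset_span (Or.inr ⟨hx, hxc⟩)
    · rintro x (rfl | hx)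
      · exact add_mem_delta hΩ (ih.2 hc) (ih.2 ha) (by rwa [form_comm_of_alternating hΩ])
      · exact ih.2 hx.1

/-- Vectors realizing the graph `E₆` have the adjacency matrix of `E₆` as their Gram matrix. -/
theorem exists_gram_of_iso_E6 (hΩ : ∀ x : V, Ω x x = 0) {X : Set V}
    (h : Nonempty (Gr Ω X ≃g E6Graph)) :
    ∃ e : ℕ → V, (∀ i < 6, e i ∈ X) ∧
      ∀ i < 6, ∀ j < 6, Ω (e i) (e j) = ofB ((row i).testBit j) := by
  obtain ⟨φ⟩ := h
  have hadj : ∀ i j : Fin 6, E6Graph.Adj i j ↔ (row i).testBit j = true := by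
    simp only [E6Graph, SimpleGraph.fromRel_adj]
    decide
  have hgr : ∀ x y : X, (Gr Ω X).Adj x y ↔ Ω x.1 y.1 = 1 := by
    intro x y
    rw [Gr, SimpleGraph.fromRel_adj, form_comm_of_alternating hΩ y.1 x.1, or_self]
    refine ⟨And.right, fun h => ⟨?_, h⟩⟩
    rintro rfl
    rw [hΩ] at h
    exact zero_ne_one h
  refine ⟨fun i => (φ.symm (Fin.ofNat 6 i)).1, fun i _ => (φ.symm _).2, fun i hi j hj => ?_⟩
  have hi' : (Fin.ofNat 6 i).val = i := Nat.mod_eq_of_lt hi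
  have hj' : (Fin.ofNat 6 j).val = j := Nat.mod_eq_of_lt hj
  have key : Ω (φ.symm (Fin.ofNat 6 i)).1 (φ.symm (Fin.ofNat 6 j)).1 = 1 ↔
      ofB ((row i).testBit j) = 1 := by
    rw [← hgr, φ.symm.map_adj_iff, hadj, hi', hj', ofB_eq_one]
  rcases eq_zero_or_one (ofB ((row i).testBit j)) with h | h
  · rw [h]
    refine (eq_zero_or_one _).resolve_right fun h1 => ?_
    rw [key.1 h1] at h
    exact one_ne_zero h
  · rw [h]
    exact key.2 h

end Orbit

/-- If `B` is a basis with `Gr(B)` connected and `B` is equivalent to a basis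
whose graph is a tree containing `E₆` as an induced subgraph, then `d(x) = 2 - Q_B(x)`
for all `x ∈ V ∖ V₀`. -/
theorem stmt_1 {V : Type*} [AddCommGroup V] [Module (ZMod 2) V]
    [FiniteDimensional (ZMod 2) V]
    (Ω : BForm V) (hΩ : ∀ x : V, Ω x x = 0)
    (B : Set V) (hB : IsBasisSet B) (hconn : (Gr Ω B).Connected)
    (hE6 : EquivToE6Tree Ω B)
    (Q : V → ZMod 2) (hQ : IsQuadForm Ω B Q) :
    ∀ x : V, x ∉ V0set Ω → dval Ω B x = 2 - (Q x).val := by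
  obtain ⟨B', hBB', htree, X, hXB, hX⟩ := hE6
  obtain ⟨hle, hsub⟩ := span_le_and_subset_delta_of_equivSets hΩ hBB'
  obtain ⟨e, heX, hgram⟩ := exists_gram_of_iso_E6 hΩ hX
  have F : E6Frame Ω Q (Delta Ω B) e :=
    { alt := hΩ
      polar := hQ.2
      value := fun x hx => quad_eq_one_of_mem_delta hQ hx
      add_mem := fun x hx y hy => add_mem_delta hΩ hx hy
      root_mem := fun i hi => hsub (hXB (heX i hi))
      gram := hgram }
  have hfull := F.full_top hsub (top_le_iff.1 (hB.2 ▸ hle)) htree.connected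
    fun i hi => hXB (heX i hi)
  intro x hx
  rcases eq_zero_or_one (Q x) with hQx | hQx
  · obtain ⟨y, hy, hxy, i, -, hi⟩ := F.exists_orthogonal x
    have hz : x + y ∈ Delta Ω B := hfull _ trivial
      (by rw [hQ.2, hQx, F.value y hy, hxy]; decide) ⟨e i, trivial, hi⟩
    have htwo : HasDeltaDecomp Ω B x 2 := by
      have hzy : Ω (x + y) y = 0 := by rw [map_add, LinearMap.add_apply, hxy, hΩ, add_zero]
      refine ⟨one_le_two, ![x + y, y], ?_, ?_, ?_⟩
      · intro i
        fin_cases i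
        exacts [hz, hy]
      · intro i j hij
        fin_cases i <;> fin_cases j
        · exact absurd rfl hij
        · exact hzy
        · exact (form_comm_of_alternating hΩ _ _).trans hzy
        · exact absurd rfl hij
      · rw [Fin.sum_univ_two]
        change x = x + y + y
        rw [add_assoc, ZModModule.add_self, add_zero]
    rw [hQx, dval]
    refine le_antisymm (Nat.sInf_le htwo) (le_csInf ⟨2, htwo⟩ ?_)
    rintro s ⟨hs, f, hf, -, hsum⟩
    by_contra hlt
    obtain rfl : s = 1 := le_antisymm (Nat.lt_succ_iff.1 (not_le.1 hlt)) hs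
    rw [Fin.sum_univ_one] at hsum
    rw [hsum, F.value _ (hf 0)] at hQx
    exact one_ne_zero hQx
  · have hxD : x ∈ Delta Ω B := by
      refine hfull x trivial hQx ?_
      by_contra! hne
      exact hx fun v => (eq_zero_or_one _).resolve_right (hne v trivial)
    have hone : HasDeltaDecomp Ω B x 1 :=
      ⟨le_rfl, fun _ => x, fun _ => hxD, fun i j hij => absurd (Subsingleton.elim i j) hij,
        by simp⟩
    rw [hQx, dval]
    exact le_antisymm (Nat.sInf_le hone) (le_csInf ⟨1, hone⟩ fun s hs => hs.1)
end
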